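/- arXiv:2206.11630 — 9 statements merged into one kernel-verified Lean document; each statement's English description precedes it below -/
import Mathlib

section
/- Let f : A → B be a morphism in C. (1) For every normal monomorphism t : T → B representing t ∈ Nsb(B), the pullback f*t := ker(coker(t) ∘ f) fits into a commuting square with left edge f*t : K → A, bottom edge f : A → B, right edge t : T → B, and top edge the unique morphism u : K → T with t ∘ u = f ∘ (f*t); this square is a pullback square in C. (2) Dually, for every normal epimorphism t : A → T representing t ∈ Nqt(A), the pushforward f_*t := coker(f ∘ ker t) fits into a commuting square with top edge f : A → B, left edge t, right edge f_*t : B → Q, and bottom edge the unique induced morphism T → Q; this square is a pushout square in C. -/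
open CategoryTheory

universe v u

/-- An ideal of "null morphisms" in a category: closed under composition with
arbitrary morphisms on either side. -/
structure NullIdeal (C : Type u) [Category.{v} C] : Type (max u v) where
  null : ∀ ⦃A B : C⦄, (A ⟶ B) → Prop
  comp_left : ∀ ⦃A B D : C⦄ (f : A ⟶ B) (g : B ⟶ D), null f → null (f ≫ g)
  comp_right : ∀ ⦃A B D : C⦄ (f : A ⟶ B) (g : B ⟶ D), null g → null (f ≫ g)

variable {C : Type u} [Category.{v} C]

/-- `k : S ⟶ A` is a kernel of `f : A ⟶ B` with respect to the ideal `N`. -/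
def IsKer (N : NullIdeal C) {S A B : C} (k : S ⟶ A) (f : A ⟶ B) : Prop :=
  N.null (k ≫ f) ∧ ∀ ⦃T : C⦄ (g : T ⟶ A), N.null (g ≫ f) → ∃! h : T ⟶ S, h ≫ k = g

/-- `q : B ⟶ Q` is a cokernel of `f : A ⟶ B` with respect to the ideal `N`. -/
def IsCoker (N : NullIdeal C) {A B Q : C} (f : A ⟶ B) (q : B ⟶ Q) : Prop :=
  N.null (f ≫ q) ∧ ∀ ⦃T : C⦄ (g : B ⟶ T), N.null (f ≫ g) → ∃! h : Q ⟶ T, q ≫ h = g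

/-- A normal monomorphism is a morphism which is a kernel of some morphism. -/
def IsNormalMonoN (N : NullIdeal C) {S A : C} (s : S ⟶ A) : Prop :=
  ∃ (B : C) (f : A ⟶ B), IsKer N s f

/-- A normal epimorphism is a morphism which is a cokernel of some morphism. -/
def IsNormalEpiN (N : NullIdeal C) {A Q : C} (q : A ⟶ Q) : Prop :=
  ∃ (B : C) (f : B ⟶ A), IsCoker N f q

/-- A choice of kernels and cokernels for all morphisms, w.r.t. the ideal `N`. -/
structure KernelChoice (N : NullIdeal C) where
  Ker : ∀ {A B : C}, (A ⟶ B) → C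
  ker : ∀ {A B : C} (f : A ⟶ B), Ker f ⟶ A
  isKer : ∀ {A B : C} (f : A ⟶ B), IsKer N (ker f) f
  Coker : ∀ {A B : C}, (A ⟶ B) → C
  coker : ∀ {A B : C} (f : A ⟶ B), B ⟶ Coker f
  isCoker : ∀ {A B : C} (f : A ⟶ B), IsCoker N f (coker f)

/-- Factorization (pre)order on (normal) subobjects of `A`. -/
def SubLe {S T A : C} (s : S ⟶ A) (t : T ⟶ A) : Prop := ∃ h : S ⟶ T, h ≫ t = s

/-- Two monomorphisms into `A` represent the same subobject of `A`. -/
def SubEquiv {S T A : C} (s : S ⟶ A) (t : T ⟶ A) : Prop := ∃ φ : S ≅ T, φ.hom ≫ t = s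

/-- Two epimorphisms out of `A` represent the same quotient object of `A`. -/
def QuotEquiv {A S T : C} (q : A ⟶ S) (r : A ⟶ T) : Prop := ∃ φ : S ≅ T, q ≫ φ.hom = r

/-- The pullback `f* t = ker (coker t ∘ f)` of a normal subobject `t` along `f`. -/
def pullN {N : NullIdeal C} (K : KernelChoice N) {A B T : C} (f : A ⟶ B) (t : T ⟶ B) :
    K.Ker (f ≫ K.coker t) ⟶ A := K.ker (f ≫ K.coker t)

/-- The pushforward `f_* s = im (f ∘ s) = ker (coker (f ∘ s))` of a normal subobject `s`
along `f`. -/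
def pushN {N : NullIdeal C} (K : KernelChoice N) {A B S : C} (f : A ⟶ B) (s : S ⟶ A) :
    K.Ker (K.coker (s ≫ f)) ⟶ B := K.ker (K.coker (s ≫ f))

/-- The image `im f = ker (coker f)`. -/
def imN {N : NullIdeal C} (K : KernelChoice N) {A B : C} (f : A ⟶ B) :
    K.Ker (K.coker f) ⟶ B := K.ker (K.coker f)

/-- The meet `s ∧ t = s_* s* t` of two normal subobjects of `A`. -/
def meetN {N : NullIdeal C} (K : KernelChoice N) {A S T : C} (s : S ⟶ A) (t : T ⟶ A) :=
  pushN K s (pullN K s t)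

/-- The join `s ∨ t = (coker t)* (coker t)_* s` of two normal subobjects of `A`. -/
def joinN {N : NullIdeal C} (K : KernelChoice N) {A S T : C} (s : S ⟶ A) (t : T ⟶ A) :=
  pullN K (K.coker t) (pushN K (K.coker t) s)

namespace IsKer

variable {N : NullIdeal C} {S A B : C} {k : S ⟶ A} {f : A ⟶ B}

theorem cancel (hk : IsKer N k f) {T : C} {a b : T ⟶ S} (h : a ≫ k = b ≫ k) : a = b :=
  (hk.2 (b ≫ k) (by rw [Category.assoc]; exact N.comp_right _ _ hk.1)).unique h rfl

/-- A kernel is a kernel of each of its cokernels. -/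
theorem isKer_of_isCoker (hk : IsKer N k f) {Q : C} {q : A ⟶ Q} (hq : IsCoker N k q) :
    IsKer N k q := by
  obtain ⟨h, rfl, -⟩ := hq.2 f hk.1
  refine ⟨hq.1, fun T g hg ↦ hk.2 g ?_⟩
  rw [← Category.assoc]
  exact N.comp_left _ _ hg

/-- Pulling back a kernel of `q` along `f` gives a kernel of `f ≫ q`. -/
theorem isPullback {Q K : C} {q : B ⟶ Q} {t : S ⟶ B} (ht : IsKer N t q) {k : K ⟶ A}
    (hk : IsKer N k (f ≫ q)) {u : K ⟶ S} (hu : u ≫ t = k ≫ f) : IsPullback u k t f := by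
  have hlift (s : Limits.PullbackCone t f) : ∃ l : s.pt ⟶ K, l ≫ k = s.snd := by
    refine (hk.2 s.snd ?_).exists
    rw [← Category.assoc, ← s.condition, Category.assoc]
    exact N.comp_right _ _ ht.1
  choose l hl using hlift
  refine ⟨⟨hu⟩, ⟨Limits.PullbackCone.IsLimit.mk hu l (fun s ↦ ht.cancel ?_) hl
    (fun s m _ hm ↦ hk.cancel (hm.trans (hl s).symm))⟩⟩
  rw [Category.assoc, hu, ← Category.assoc, hl, s.condition]

end IsKer

namespace IsCoker

variable {N : NullIdeal C} {A B Q : C} {f : A ⟶ B} {q : B ⟶ Q}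

theorem cancel (hq : IsCoker N f q) {T : C} {a b : Q ⟶ T} (h : q ≫ a = q ≫ b) : a = b :=
  (hq.2 (q ≫ b) (by rw [← Category.assoc]; exact N.comp_left _ _ hq.1)).unique h rfl

/-- A cokernel is a cokernel of each of its kernels. -/
theorem isCoker_of_isKer (hq : IsCoker N f q) {S : C} {k : S ⟶ B} (hk : IsKer N k q) :
    IsCoker N k q := by
  obtain ⟨h, rfl, -⟩ := hk.2 f hq.1
  refine ⟨hk.1, fun T g hg ↦ hq.2 g ?_⟩
  rw [Category.assoc]
  exact N.comp_right _ _ hg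

/-- Pushing out a cokernel of `k` along `f` gives a cokernel of `k ≫ f`. -/
theorem isPushout {S P : C} {k : S ⟶ A} {t : A ⟶ Q} (ht : IsCoker N k t) {p : B ⟶ P}
    (hp : IsCoker N (k ≫ f) p) {w : Q ⟶ P} (hw : t ≫ w = f ≫ p) : IsPushout t f w p := by
  have hdesc (s : Limits.PushoutCocone t f) : ∃ l : P ⟶ s.pt, p ≫ l = s.inr := by
    refine (hp.2 s.inr ?_).exists
    rw [Category.assoc, ← s.condition, ← Category.assoc]
    exact N.comp_left _ _ ht.1
  choose l hl using hdesc
  refine ⟨⟨hw⟩, ⟨Limits.PushoutCocone.IsColimit.mk hw l (fun s ↦ ht.cancel ?_) hl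
    (fun s m _ hm ↦ hp.cancel (hm.trans (hl s).symm))⟩⟩
  rw [← Category.assoc, hw, Category.assoc, hl, s.condition]

end IsCoker

/-- The square defining the pullback `f* t = ker (coker t ∘ f)` of a normal subobject `t`
along `f` is a pullback square in `C`, and dually the square defining the pushforward
`f_* t = coker (f ∘ ker t)` of a normal quotient `t` along `f` is a pushout square in `C`. -/
theorem stmt1 (N : NullIdeal C) (K : KernelChoice N) :
    (∀ {A B T : C} (f : A ⟶ B) (t : T ⟶ B), IsNormalMonoN N t →
      ∃ u : K.Ker (f ≫ K.coker t) ⟶ T,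
        (u ≫ t = K.ker (f ≫ K.coker t) ≫ f ∧
          ∀ u' : K.Ker (f ≫ K.coker t) ⟶ T,
            u' ≫ t = K.ker (f ≫ K.coker t) ≫ f → u' = u) ∧
        IsPullback u (K.ker (f ≫ K.coker t)) t f) ∧
    (∀ {A B T : C} (f : A ⟶ B) (t : A ⟶ T), IsNormalEpiN N t →
      ∃ v : T ⟶ K.Coker (K.ker t ≫ f),
        (t ≫ v = f ≫ K.coker (K.ker t ≫ f) ∧
          ∀ v' : T ⟶ K.Coker (K.ker t ≫ f),
            t ≫ v' = f ≫ K.coker (K.ker t ≫ f) → v' = v) ∧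
        IsPushout t f v (K.coker (K.ker t ≫ f))) := by
  refine ⟨fun f t ⟨_, _, ht⟩ ↦ ?_, fun f t ⟨_, _, ht⟩ ↦ ?_⟩
  · have ht' := ht.isKer_of_isCoker (K.isCoker t)
    have hk := K.isKer (f ≫ K.coker t)
    obtain ⟨u, hu, huniq⟩ := ht'.2 (K.ker (f ≫ K.coker t) ≫ f)
      (by rw [Category.assoc]; exact hk.1)
    exact ⟨u, ⟨hu, huniq⟩, ht'.isPullback hk hu⟩
  · have ht' := ht.isCoker_of_isKer (K.isKer t)
    have hp := K.isCoker (K.ker t ≫ f)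
    obtain ⟨w, hw, huniq⟩ := ht'.2 (f ≫ K.coker (K.ker t ≫ f))
      (by rw [← Category.assoc]; exact hp.1)
    exact ⟨w, ⟨hw, huniq⟩, ht'.isPushout hp hw⟩
end

section
/- Let s, t ∈ Nsb(A) be normal subobjects of an object A of C. Then the composites s ∘ (s*t) and t ∘ (t*s) are normal monomorphisms into A, and they represent the same normal subobject of A, namely s_* s* t = t_* t* s. -/
open CategoryTheory

universe v u

variable {C : Type u} [Category.{v} C]

theorem IsKer.mono {N : NullIdeal C} {S A B : C} {k : S ⟶ A} {f : A ⟶ B} (hk : IsKer N k f) :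
    Mono k where
  right_cancellation g h hgh :=
    (hk.2 (h ≫ k) (by simpa using N.comp_right h _ hk.1)).unique hgh rfl

/-- Monomorphisms that factor through each other represent the same subobject. -/
theorem SubLe.subEquiv {S T A : C} {s : S ⟶ A} {t : T ⟶ A} [Mono s] [Mono t]
    (hst : SubLe s t) (hts : SubLe t s) : SubEquiv s t := by
  obtain ⟨f, hf⟩ := hst
  obtain ⟨g, hg⟩ := hts
  exact ⟨⟨f, g, by simp [← cancel_mono s, hf, hg], by simp [← cancel_mono t, hf, hg]⟩, hf⟩

theorem IsKer.subEquiv {N : NullIdeal C} {S T A B : C} {k : S ⟶ A} {l : T ⟶ A} {f : A ⟶ B}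
    (hk : IsKer N k f) (hl : IsKer N l f) : SubEquiv k l :=
  have := hk.mono
  have := hl.mono
  SubLe.subEquiv (hl.2 k hk.1).exists (hk.2 l hl.1).exists

theorem IsCoker.null_comp {N : NullIdeal C} {A B Q X Y : C} {f : A ⟶ B} {q : B ⟶ Q}
    (hq : IsCoker N f q) {g : X ⟶ B} (hg : N.null (g ≫ q)) {h : B ⟶ Y} (hh : N.null (f ≫ h)) :
    N.null (g ≫ h) := by
  obtain ⟨e, rfl⟩ := (hq.2 h hh).exists
  simpa using N.comp_left _ e hg

/-- A normal monomorphism is a kernel of its cokernel. -/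
theorem IsNormalMonoN.isKer_of_isCoker {N : NullIdeal C} {S A Q : C} {s : S ⟶ A}
    (hs : IsNormalMonoN N s) {q : A ⟶ Q} (hq : IsCoker N s q) : IsKer N s q := by
  obtain ⟨B, f, hf⟩ := hs
  exact ⟨hq.1, fun _ g hg => hf.2 g (hq.null_comp hg hf.1)⟩

theorem pullN_comp_null {N : NullIdeal C} (K : KernelChoice N) {A S T : C}
    (s : S ⟶ A) (t : T ⟶ A) : N.null ((pullN K s t ≫ s) ≫ K.coker t) := by
  simpa [pullN] using (K.isKer (s ≫ K.coker t)).1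

theorem mono_pullN_comp {N : NullIdeal C} (K : KernelChoice N) {A S T : C}
    {s : S ⟶ A} (t : T ⟶ A) (hs : IsNormalMonoN N s) : Mono (pullN K s t ≫ s) := by
  obtain ⟨_, _, hf⟩ := hs
  have := hf.mono
  have : Mono (pullN K s t) := (K.isKer (s ≫ K.coker t)).mono
  exact mono_comp _ _

/-- Every morphism annihilated by both cokernels factors through the composite of `s` and `s* t`. -/
theorem subLe_pullN_comp {N : NullIdeal C} (K : KernelChoice N) {A S T X : C}
    {s : S ⟶ A} {t : T ⟶ A} (hs : IsNormalMonoN N s) {g : X ⟶ A}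
    (hgs : N.null (g ≫ K.coker s)) (hgt : N.null (g ≫ K.coker t)) :
    SubLe g (pullN K s t ≫ s) := by
  obtain ⟨h, rfl⟩ := ((hs.isKer_of_isCoker (K.isCoker s)).2 g hgs).exists
  obtain ⟨e, he⟩ := ((K.isKer (s ≫ K.coker t)).2 h (by simpa using hgt)).exists
  exact ⟨e, by rw [pullN, ← Category.assoc, he]⟩

theorem isKer_pullN_comp {N : NullIdeal C} (K : KernelChoice N) {A S T : C}
    {s : S ⟶ A} (t : T ⟶ A) (hs : IsNormalMonoN N s) :
    IsKer N (pullN K s t ≫ s) (K.coker (pullN K s t ≫ s)) := by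
  have hq := K.isCoker (pullN K s t ≫ s)
  refine ⟨hq.1, fun X g hg => ?_⟩
  obtain ⟨h, hh⟩ := subLe_pullN_comp K hs
    (hq.null_comp hg (by simpa using N.comp_right (pullN K s t) _ (K.isCoker s).1))
    (hq.null_comp hg (pullN_comp_null K s t))
  have := mono_pullN_comp K t hs
  exact ⟨h, hh, fun y hy => (cancel_mono _).1 (hy.trans hh.symm)⟩

theorem subLe_pullN_comp_swap {N : NullIdeal C} (K : KernelChoice N) {A S T : C}
    (s : S ⟶ A) {t : T ⟶ A} (ht : IsNormalMonoN N t) :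
    SubLe (pullN K s t ≫ s) (pullN K t s ≫ t) :=
  subLe_pullN_comp K ht (pullN_comp_null K s t)
    (by simpa using N.comp_right (pullN K s t) _ (K.isCoker s).1)

/-- For normal subobjects `s, t` of `A`, the composites `s ∘ (s* t)` and `t ∘ (t* s)` are
normal monomorphisms into `A` representing the same normal subobject, namely
`s_* s* t = t_* t* s`. -/
theorem stmt2 (N : NullIdeal C) (K : KernelChoice N)
    {A S T : C} (s : S ⟶ A) (t : T ⟶ A)
    (hs : IsNormalMonoN N s) (ht : IsNormalMonoN N t) :
    IsNormalMonoN N (pullN K s t ≫ s) ∧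
    IsNormalMonoN N (pullN K t s ≫ t) ∧
    SubEquiv (pullN K s t ≫ s) (pullN K t s ≫ t) ∧
    SubEquiv (pullN K s t ≫ s) (meetN K s t) ∧
    SubEquiv (pullN K t s ≫ t) (meetN K t s) := by
  have := mono_pullN_comp K t hs
  have := mono_pullN_comp K s ht
  have hst := isKer_pullN_comp K t hs
  have hts := isKer_pullN_comp K s ht
  exact ⟨⟨_, _, hst⟩, ⟨_, _, hts⟩,
    SubLe.subEquiv (subLe_pullN_comp_swap K s ht) (subLe_pullN_comp_swap K t hs),
    hst.subEquiv (K.isKer _), hts.subEquiv (K.isKer _)⟩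
end

section
/- For every morphism f : A → B in C and all normal subobjects s ∈ Nsb(A) and t ∈ Nsb(B), one has s ≤ f*t in Nsb(A) if and only if f_*s ≤ t in Nsb(B). In other words, the pushforward f_* : Nsb(A) → Nsb(B) is left adjoint to the pullback f* : Nsb(B) → Nsb(A) (a Galois connection). -/
open CategoryTheory

universe v u

variable {C : Type u} [Category.{v} C]

theorem IsKer.subLe_iff {N : NullIdeal C} {S A B X : C} {k : S ⟶ A} {g : A ⟶ B}
    (hk : IsKer N k g) (x : X ⟶ A) : SubLe x k ↔ N.null (x ≫ g) := by
  constructor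
  · rintro ⟨h, rfl⟩
    rw [Category.assoc]
    exact N.comp_right _ _ hk.1
  · intro hx
    exact (hk.2 x hx).exists

/-- A normal monomorphism is a kernel of each of its cokernels. -/
theorem IsNormalMonoN.subLe_iff {N : NullIdeal C} {S A Q X : C} {t : S ⟶ A} {q : A ⟶ Q}
    (ht : IsNormalMonoN N t) (hq : IsCoker N t q) (x : X ⟶ A) :
    SubLe x t ↔ N.null (x ≫ q) := by
  constructor
  · rintro ⟨h, rfl⟩
    rw [Category.assoc]
    exact N.comp_right _ _ hq.1
  · intro hx
    obtain ⟨B, g, hg⟩ := ht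
    obtain ⟨h, rfl⟩ := (hq.2 g hg.1).exists
    rw [hg.subLe_iff, ← Category.assoc]
    exact N.comp_left _ _ hx

/-- A morphism and its image are annihilated by the same morphisms. -/
theorem null_imN_comp_iff {N : NullIdeal C} (K : KernelChoice N) {A B D : C}
    (u : A ⟶ B) (g : B ⟶ D) : N.null (imN K u ≫ g) ↔ N.null (u ≫ g) := by
  constructor
  · intro h
    obtain ⟨e, he⟩ := ((K.isKer (K.coker u)).2 u (K.isCoker u).1).exists
    rw [← he, Category.assoc]
    exact N.comp_right _ _ h
  · intro h
    obtain ⟨m, rfl⟩ := ((K.isCoker u).2 g h).exists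
    rw [← Category.assoc]
    exact N.comp_left _ _ (K.isKer (K.coker u)).1

/-- Galois connection: `s ≤ f* t` in `Nsb A` iff `f_* s ≤ t` in `Nsb B`, i.e. the
pushforward is left adjoint to the pullback. -/
theorem stmt3 (N : NullIdeal C) (K : KernelChoice N)
    {A B S T : C} (f : A ⟶ B) (s : S ⟶ A) (t : T ⟶ B)
    (hs : IsNormalMonoN N s) (ht : IsNormalMonoN N t) :
    SubLe s (pullN K f t) ↔ SubLe (pushN K f s) t := by
  have hpush : N.null (pushN K f s ≫ K.coker t) ↔ N.null ((s ≫ f) ≫ K.coker t) :=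
    null_imN_comp_iff K (s ≫ f) (K.coker t)
  rw [ht.subLe_iff (K.isCoker t), hpush, Category.assoc]
  exact (K.isKer (f ≫ K.coker t)).subLe_iff s
end

section
/- Fix ε ∈ (0,1) and let f : V → W be a linear contraction between real seminormed spaces. Define p(x) := max(‖x‖, ε⁻¹‖f(x)‖) for x ∈ V. Then: (1) p is a seminorm on V with ‖x‖ ≤ p(x) ≤ ε⁻¹‖x‖ for all x; (2) ‖f(x)‖ ≤ ε·p(x) for all x; (3) for every real seminormed space U and every linear contraction g : U → V with ‖f(g(u))‖ ≤ ε‖u‖ for all u ∈ U, one has p(g(u)) ≤ ‖u‖ for all u ∈ U. (Thus the identity map (V, p) → (V, ‖·‖) is the ε-kernel of f.) -/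
universe u

/-- The ε-kernel of a linear contraction `f : V → W` between real seminormed spaces:
`p x = max (‖x‖, ε⁻¹ ‖f x‖)` is a seminorm on `V` with `‖x‖ ≤ p x ≤ ε⁻¹ ‖x‖`, it
satisfies `‖f x‖ ≤ ε p x`, and every linear contraction `g : U → V` with `‖f ∘ g‖ ≤ ε`
is a contraction into `(V, p)`; thus the identity `(V, p) → (V, ‖·‖)` is the ε-kernel
of `f`. -/
theorem stmt11 {V W : Type*} [SeminormedAddCommGroup V] [NormedSpace ℝ V]
    [SeminormedAddCommGroup W] [NormedSpace ℝ W]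
    (ε : ℝ) (hε : ε ∈ Set.Ioo (0 : ℝ) 1)
    (f : V →ₗ[ℝ] W) (hf : ∀ x, ‖f x‖ ≤ ‖x‖)
    (p : V → ℝ) (hp : ∀ x, p x = max ‖x‖ (ε⁻¹ * ‖f x‖)) :
    -- (1) `p` is a seminorm squeezed between `‖·‖` and `ε⁻¹ ‖·‖`
    (∃ P : Seminorm ℝ V, ∀ x, P x = p x) ∧
    (∀ x, ‖x‖ ≤ p x ∧ p x ≤ ε⁻¹ * ‖x‖) ∧
    -- (2)
    (∀ x, ‖f x‖ ≤ ε * p x) ∧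
    -- (3) the universal property of the ε-kernel
    (∀ (U : Type u) [SeminormedAddCommGroup U] [NormedSpace ℝ U],
      ∀ g : U →ₗ[ℝ] V, (∀ u, ‖g u‖ ≤ ‖u‖) → (∀ u, ‖f (g u)‖ ≤ ε * ‖u‖) →
        ∀ u, p (g u) ≤ ‖u‖) := by
  obtain ⟨h0, h1⟩ := hε
  have hinv : 0 ≤ ε⁻¹ := inv_nonneg.mpr h0.le
  have hone : 1 ≤ ε⁻¹ := (one_le_inv₀ h0).mpr h1.le
  refine ⟨⟨Seminorm.of p ?_ ?_, fun _ => rfl⟩, fun x => ⟨?_, ?_⟩, fun x => ?_, ?_⟩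
  · intro x y
    rw [hp, hp, hp, map_add]
    refine max_le ((norm_add_le x y).trans (add_le_add (le_max_left _ _) (le_max_left _ _))) ?_
    calc ε⁻¹ * ‖f x + f y‖ ≤ ε⁻¹ * (‖f x‖ + ‖f y‖) :=
          mul_le_mul_of_nonneg_left (norm_add_le _ _) hinv
      _ = ε⁻¹ * ‖f x‖ + ε⁻¹ * ‖f y‖ := mul_add _ _ _
      _ ≤ _ := add_le_add (le_max_right _ _) (le_max_right _ _)
  · intro a x
    rw [hp, hp, map_smul, norm_smul, norm_smul, mul_max_of_nonneg _ _ (norm_nonneg a),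
      mul_left_comm]
  · rw [hp]
    exact le_max_left _ _
  · rw [hp]
    exact max_le (le_mul_of_one_le_left (norm_nonneg x) hone)
      (mul_le_mul_of_nonneg_left (hf x) hinv)
  · rw [hp, ← inv_mul_le_iff₀ h0]
    exact le_max_right _ _
  · intro U _ _ g hg hfg u
    rw [hp]
    exact max_le (hg u) ((inv_mul_le_iff₀ h0).mpr (hfg u))
end

section
/- Fix ε ∈ (0,1) and let f : V → W be a linear contraction between real seminormed spaces. Define q(y) := inf_{x ∈ V} (‖y − f(x)‖ + ε‖x‖) for y ∈ W. Then: (1) q is a seminorm on W with q(y) ≤ ‖y‖ for all y; (2) q(f(x)) ≤ ε‖x‖ for all x ∈ V; (3) for every real seminormed space X and every linear contraction h : W → X with ‖h(f(x))‖ ≤ ε‖x‖ for all x ∈ V, one has ‖h(y)‖ ≤ q(y) for all y ∈ W. (Thus the identity map (W, ‖·‖) → (W, q) is the ε-cokernel of f.) -/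
universe u

section EpsilonCokernel

variable {V W : Type*} [SeminormedAddCommGroup V] [NormedSpace ℝ V]
  [SeminormedAddCommGroup W] [NormedSpace ℝ W]

theorem iInf_norm_sub_add_le {c : ℝ} (hc : 0 ≤ c) (f : V →ₗ[ℝ] W) (y : W) (x : V) :
    ⨅ x : V, (‖y - f x‖ + c * ‖x‖) ≤ ‖y - f x‖ + c * ‖x‖ :=
  ciInf_le ⟨0, by rintro _ ⟨x, rfl⟩; positivity⟩ x

theorem iInf_norm_sub_add_le_norm {c : ℝ} (hc : 0 ≤ c) (f : V →ₗ[ℝ] W) (y : W) :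
    ⨅ x : V, (‖y - f x‖ + c * ‖x‖) ≤ ‖y‖ := by
  simpa using iInf_norm_sub_add_le hc f y 0

/-- The seminorm `y ↦ inf_x (‖y - f x‖ + c ‖x‖)` on the codomain of a linear map `f`. -/
noncomputable def cokernelSeminorm {c : ℝ} (hc : 0 ≤ c) (f : V →ₗ[ℝ] W) : Seminorm ℝ W :=
  Seminorm.ofSMulLE (fun y => ⨅ x : V, (‖y - f x‖ + c * ‖x‖))
    (le_antisymm (by simpa using iInf_norm_sub_add_le_norm hc f 0)
      (Real.iInf_nonneg fun x => by positivity))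
    (fun y z => le_ciInf_add_ciInf fun x x' => by
      have hnorm : ‖y + z - f (x + x')‖ ≤ ‖y - f x‖ + ‖z - f x'‖ := by
        rw [map_add, add_sub_add_comm]
        exact norm_add_le _ _
      have hc' := mul_le_mul_of_nonneg_left (norm_add_le x x') hc
      linarith [iInf_norm_sub_add_le hc f (y + z) (x + x')])
    (fun r y => by
      rw [Real.mul_iInf_of_nonneg (norm_nonneg r)]
      refine le_ciInf fun x => (iInf_norm_sub_add_le hc f (r • y) (r • x)).trans_eq ?_
      rw [map_smul, ← smul_sub, norm_smul, norm_smul]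
      ring)

end EpsilonCokernel

/-- The ε-cokernel of a linear contraction `f : V → W` between real seminormed spaces:
`q y = inf_x (‖y − f x‖ + ε ‖x‖)` is a seminorm on `W` with `q ≤ ‖·‖`, it satisfies
`q (f x) ≤ ε ‖x‖`, and every linear contraction `h : W → X` with `‖h ∘ f‖ ≤ ε` is a
contraction out of `(W, q)`; thus the identity `(W, ‖·‖) → (W, q)` is the ε-cokernel
of `f`. -/
theorem stmt12 {V W : Type*} [SeminormedAddCommGroup V] [NormedSpace ℝ V]
    [SeminormedAddCommGroup W] [NormedSpace ℝ W]
    (ε : ℝ) (hε : ε ∈ Set.Ioo (0 : ℝ) 1)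
    (f : V →ₗ[ℝ] W) (hf : ∀ x, ‖f x‖ ≤ ‖x‖)
    (q : W → ℝ) (hq : ∀ y, q y = ⨅ x : V, (‖y - f x‖ + ε * ‖x‖)) :
    -- (1) `q` is a seminorm dominated by `‖·‖`
    (∃ Q : Seminorm ℝ W, ∀ y, Q y = q y) ∧
    (∀ y, q y ≤ ‖y‖) ∧
    -- (2)
    (∀ x, q (f x) ≤ ε * ‖x‖) ∧
    -- (3) the universal property of the ε-cokernel
    (∀ (X : Type u) [SeminormedAddCommGroup X] [NormedSpace ℝ X],
      ∀ h : W →ₗ[ℝ] X, (∀ y, ‖h y‖ ≤ ‖y‖) → (∀ x, ‖h (f x)‖ ≤ ε * ‖x‖) →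
        ∀ y, ‖h y‖ ≤ q y) := by
  obtain rfl : q = fun y => ⨅ x : V, (‖y - f x‖ + ε * ‖x‖) := funext hq
  have hε₀ : 0 ≤ ε := hε.1.le
  refine ⟨⟨cokernelSeminorm hε₀ f, fun _ => rfl⟩, iInf_norm_sub_add_le_norm hε₀ f,
    fun x => ?_, fun X _ _ h hh hhf y => le_ciInf fun x => ?_⟩
  · simpa using iInf_norm_sub_add_le hε₀ f (f x) x
  · calc ‖h y‖ = ‖h (y - f x) + h (f x)‖ := by rw [← map_add, sub_add_cancel]
      _ ≤ ‖h (y - f x)‖ + ‖h (f x)‖ := norm_add_le _ _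
      _ ≤ ‖y - f x‖ + ε * ‖x‖ := add_le_add (hh _) (hhf x)
end

section
/- Fix ε ∈ (0,1) and let f : V → W be a linear contraction between real seminormed spaces. Then for every x ∈ V, inf_{x' ∈ V} ( ‖x − x'‖ + max(ε‖x'‖, ‖f(x')‖) ) = max(ε‖x‖, ‖f(x)‖). (That is, the ε-coimage seminorm of f equals x ↦ max(ε‖x‖, ‖f(x)‖).) -/
/-- The ε-coimage seminorm of a linear contraction `f : V → W` between real seminormed
spaces, i.e. the ε-cokernel seminorm of the ε-kernel inclusion of `f`, equals
`x ↦ max (ε ‖x‖, ‖f x‖)`. -/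
theorem stmt13 {V W : Type*} [SeminormedAddCommGroup V] [NormedSpace ℝ V]
    [SeminormedAddCommGroup W] [NormedSpace ℝ W]
    (ε : ℝ) (hε : ε ∈ Set.Ioo (0 : ℝ) 1)
    (f : V →ₗ[ℝ] W) (hf : ∀ x, ‖f x‖ ≤ ‖x‖) (x : V) :
    (⨅ x' : V, (‖x - x'‖ + max (ε * ‖x'‖) ‖f x'‖)) = max (ε * ‖x‖) ‖f x‖ := by
  obtain ⟨hε0, hε1⟩ := hε
  apply le_antisymm
  · have hbdd : BddBelow (Set.range fun x' : V => ‖x - x'‖ + max (ε * ‖x'‖) ‖f x'‖) := by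
      refine ⟨0, ?_⟩
      rintro _ ⟨y, rfl⟩
      positivity
    simpa using ciInf_le hbdd x
  · refine le_ciInf fun y => max_le ?_ ?_
    · calc ε * ‖x‖ ≤ ε * (‖x - y‖ + ‖y‖) := by
            gcongr
            exact norm_le_norm_sub_add x y
        _ = ε * ‖x - y‖ + ε * ‖y‖ := mul_add _ _ _
        _ ≤ ‖x - y‖ + max (ε * ‖y‖) ‖f y‖ :=
            add_le_add (mul_le_of_le_one_left (norm_nonneg _) hε1.le) (le_max_left _ _)
    · calc ‖f x‖ ≤ ‖f x - f y‖ + ‖f y‖ := norm_le_norm_sub_add _ _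
        _ = ‖f (x - y)‖ + ‖f y‖ := by rw [map_sub]
        _ ≤ ‖x - y‖ + max (ε * ‖y‖) ‖f y‖ := add_le_add (hf _) (le_max_right _ _)
end

section
/- Fix ε ∈ (0,1) and let f : V → W be a linear contraction between real seminormed spaces. Then the following are equivalent: (i) f is a normal ε-monomorphism, i.e., f is an ε-kernel of some linear contraction out of W; (ii) f is a normal ε-epimorphism, i.e., f is an ε-cokernel of some linear contraction into V; (iii) f is essentially surjective (for every y ∈ W there exists x ∈ V with ‖y − f(x)‖ = 0) and ε‖x‖ ≤ ‖f(x)‖ for all x ∈ V. -/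
universe u

/-- A bundled real seminormed space. -/
structure SNS : Type (u + 1) where
  carrier : Type u
  [str : SeminormedAddCommGroup carrier]
  [mod : NormedSpace ℝ carrier]

attribute [instance] SNS.str SNS.mod

/-- A linear map between seminormed spaces is a contraction. -/
def Contraction {V W : SNS.{u}} (f : V.carrier →ₗ[ℝ] W.carrier) : Prop :=
  ∀ x, ‖f x‖ ≤ ‖x‖

/-- `f : V → W` is an ε-kernel of the contraction `g : W → X`: the composite has norm
`≤ ε`, and every contraction `h` with `‖g ∘ h‖ ≤ ε` factors through `f`, uniquely up to
null difference. -/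
def IsEpsKernel (ε : ℝ) {V W X : SNS.{u}} (f : V.carrier →ₗ[ℝ] W.carrier)
    (g : W.carrier →ₗ[ℝ] X.carrier) : Prop :=
  (∀ x, ‖g (f x)‖ ≤ ε * ‖x‖) ∧
  ∀ (U : SNS.{u}) (h : U.carrier →ₗ[ℝ] W.carrier), Contraction h →
    (∀ u, ‖g (h u)‖ ≤ ε * ‖u‖) →
    ∃ k : U.carrier →ₗ[ℝ] V.carrier, Contraction k ∧ (∀ u, ‖h u - f (k u)‖ = 0) ∧
      ∀ k' : U.carrier →ₗ[ℝ] V.carrier, Contraction k' → (∀ u, ‖h u - f (k' u)‖ = 0) →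
        ∀ u, ‖k u - k' u‖ = 0

/-- `f : V → W` is an ε-cokernel of the contraction `e : U → V`: the composite has norm
`≤ ε`, and every contraction `h` with `‖h ∘ e‖ ≤ ε` factors through `f`, uniquely up to
null difference. -/
def IsEpsCokernel (ε : ℝ) {U V W : SNS.{u}} (e : U.carrier →ₗ[ℝ] V.carrier)
    (f : V.carrier →ₗ[ℝ] W.carrier) : Prop :=
  (∀ u, ‖f (e u)‖ ≤ ε * ‖u‖) ∧
  ∀ (X : SNS.{u}) (h : V.carrier →ₗ[ℝ] X.carrier), Contraction h →
    (∀ u, ‖h (e u)‖ ≤ ε * ‖u‖) →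
    ∃ k : W.carrier →ₗ[ℝ] X.carrier, Contraction k ∧ (∀ v, ‖h v - k (f v)‖ = 0) ∧
      ∀ k' : W.carrier →ₗ[ℝ] X.carrier, Contraction k' → (∀ v, ‖h v - k' (f v)‖ = 0) →
        ∀ w, ‖k w - k' w‖ = 0

/-- The space `V` with the seminorm induced by a linear map `T : V → Y`. -/
noncomputable abbrev SNS.induced (V : SNS.{u}) {Y : Type u} [SeminormedAddCommGroup Y] [NormedSpace ℝ Y]
    (T : V.carrier →ₗ[ℝ] Y) : SNS.{u} :=
  @SNS.mk V.carrier (SeminormedAddCommGroup.induced V.carrier Y T)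
    (NormedSpace.induced ℝ V.carrier Y T)

/-- The identity of `V`, as a linear equivalence to `V` with an induced seminorm. -/
def SNS.toInduced (V : SNS.{u}) {Y : Type u} [SeminormedAddCommGroup Y] [NormedSpace ℝ Y]
    (T : V.carrier →ₗ[ℝ] Y) : V.carrier ≃ₗ[ℝ] (V.induced T).carrier where
  toFun x := x
  invFun x := x
  map_add' _ _ := rfl
  map_smul' _ _ := rfl
  left_inv _ := rfl
  right_inv _ := rfl

theorem SNS.norm_toInduced (V : SNS.{u}) {Y : Type u} [SeminormedAddCommGroup Y]
    [NormedSpace ℝ Y] (T : V.carrier →ₗ[ℝ] Y) (x : V.carrier) :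
    ‖V.toInduced T x‖ = ‖T x‖ :=
  rfl

theorem norm_eq_of_norm_sub_eq_zero {E : Type*} [SeminormedAddCommGroup E] {x y : E}
    (h : ‖x - y‖ = 0) : ‖x‖ = ‖y‖ := by
  have := abs_norm_sub_norm_le x y
  rw [h] at this
  exact sub_eq_zero.mp (abs_nonpos_iff.mp this)

theorem norm_sub_eq_zero_trans {E : Type*} [SeminormedAddCommGroup E] {x y z : E}
    (h₁ : ‖x - y‖ = 0) (h₂ : ‖y - z‖ = 0) : ‖x - z‖ = 0 := by
  have := norm_sub_le_norm_sub_add_norm_sub x y z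
  linarith [norm_nonneg (x - z)]

theorem norm_sub_eq_zero_symm {E : Type*} [SeminormedAddCommGroup E] {x y : E}
    (h : ‖x - y‖ = 0) : ‖y - x‖ = 0 := by
  rwa [norm_sub_rev]

theorem Contraction.norm_sub_eq_zero {V W : SNS.{u}} {f : V.carrier →ₗ[ℝ] W.carrier}
    (hf : Contraction f) {x y : V.carrier} (h : ‖x - y‖ = 0) : ‖f x - f y‖ = 0 := by
  rw [← map_sub]
  exact le_antisymm ((hf _).trans h.le) (norm_nonneg _)

/-- An essentially surjective linear map has a linear section up to null difference. -/
theorem exists_linear_section_of_essSurj {V W : SNS.{u}} (f : V.carrier →ₗ[ℝ] W.carrier)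
    (hf : ∀ y : W.carrier, ∃ x : V.carrier, ‖y - f x‖ = 0) :
    ∃ s : W.carrier →ₗ[ℝ] V.carrier, ∀ y, ‖f (s y) - y‖ = 0 := by
  let N : Submodule ℝ W.carrier :=
    { carrier := {x | ‖x‖ = 0}
      zero_mem' := norm_zero
      add_mem' := fun {a b} ha hb => by
        have := norm_add_le a b
        simp only [Set.mem_ofPred_eq] at ha hb ⊢
        linarith [norm_nonneg (a + b)]
      smul_mem' := fun c x hx => by
        simp only [Set.mem_ofPred_eq] at hx ⊢
        rw [norm_smul, hx, mul_zero] }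
  have hsurj : LinearMap.range (N.mkQ ∘ₗ f) = ⊤ := by
    rw [LinearMap.range_eq_top]
    intro q
    obtain ⟨y, rfl⟩ := N.mkQ_surjective q
    obtain ⟨x, hx⟩ := hf y
    exact ⟨x, ((Submodule.Quotient.eq N).2 hx).symm⟩
  obtain ⟨t, ht⟩ := (N.mkQ ∘ₗ f).exists_rightInverse_of_surjective hsurj
  exact ⟨t ∘ₗ N.mkQ, fun y =>
    (Submodule.Quotient.eq N).1 (LinearMap.congr_fun ht (N.mkQ y))⟩

section

variable {ε : ℝ} {V W : SNS.{u}} {f : V.carrier →ₗ[ℝ] W.carrier}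

theorem IsEpsKernel.essSurj_and_bound {X : SNS.{u}} {g : W.carrier →ₗ[ℝ] X.carrier}
    (hε : ε ∈ Set.Ioo (0 : ℝ) 1) (hf : Contraction f) (hg : Contraction g)
    (h : IsEpsKernel ε f g) :
    (∀ y : W.carrier, ∃ x : V.carrier, ‖y - f x‖ = 0) ∧
      ∀ x : V.carrier, ε * ‖x‖ ≤ ‖f x‖ := by
  obtain ⟨hε0, hε1⟩ := hε
  obtain ⟨hgf, huniv⟩ := h
  let T : W.carrier →ₗ[ℝ] W.carrier × X.carrier := LinearMap.prod LinearMap.id (ε⁻¹ • g)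
  let ι := W.toInduced T
  have hι (w : W.carrier) : ‖ι w‖ = max ‖w‖ (ε⁻¹ * ‖g w‖) := by
    rw [← abs_of_pos (inv_pos.2 hε0), ← Real.norm_eq_abs, ← norm_smul]
    rfl
  obtain ⟨k, hk, hfk, -⟩ := huniv (W.induced T) ι.symm.toLinearMap
    (fun u => by
      obtain ⟨w, rfl⟩ := ι.surjective u
      simp [hι])
    (fun u => by
      obtain ⟨w, rfl⟩ := ι.surjective u
      rw [hι, LinearEquiv.coe_coe, ι.symm_apply_apply, ← inv_mul_le_iff₀ hε0]
      exact le_max_right _ _)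
  have hfk' (w : W.carrier) : ‖w - f (k (ι w))‖ = 0 := by simpa using hfk (ι w)
  refine ⟨fun y => ⟨k (ι y), hfk' y⟩, fun x => ?_⟩
  obtain ⟨k₀, -, -, huniq⟩ := huniv V f hf hgf
  have h₁ := huniq LinearMap.id (fun _ => le_rfl) (fun _ => by simp) x
  have h₂ := huniq (k ∘ₗ ι.toLinearMap ∘ₗ f)
    (fun v => (hk _).trans <| (hι (f v)).trans_le <|
      max_le (hf v) ((inv_mul_le_iff₀ hε0).2 (hgf v)))
    (fun v => hfk' (f v)) x
  have hx : ‖x‖ = ‖k (ι (f x))‖ :=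
    norm_eq_of_norm_sub_eq_zero (norm_sub_eq_zero_trans (norm_sub_eq_zero_symm h₁) h₂)
  rw [← le_inv_mul_iff₀ hε0, hx]
  refine (hk _).trans ((hι (f x)).trans_le (max_le ?_ ?_))
  · exact le_mul_of_one_le_left (norm_nonneg _) ((one_le_inv₀ hε0).2 hε1.le)
  · exact mul_le_mul_of_nonneg_left (hg _) (inv_pos.2 hε0).le

theorem IsEpsCokernel.essSurj_and_bound {U : SNS.{u}} {e : U.carrier →ₗ[ℝ] V.carrier}
    (hε : ε ∈ Set.Ioo (0 : ℝ) 1) (hf : Contraction f) (he : Contraction e)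
    (h : IsEpsCokernel ε e f) :
    (∀ y : W.carrier, ∃ x : V.carrier, ‖y - f x‖ = 0) ∧
      ∀ x : V.carrier, ε * ‖x‖ ≤ ‖f x‖ := by
  obtain ⟨hε0, hε1⟩ := hε
  obtain ⟨hfe, huniv⟩ := h
  let T : V.carrier →ₗ[ℝ] V.carrier × W.carrier := LinearMap.prod (ε • LinearMap.id) f
  let ι := V.toInduced T
  have hι (v : V.carrier) : ‖ι v‖ = max (ε * ‖v‖) ‖f v‖ := by
    conv_rhs => rw [← abs_of_pos hε0, ← Real.norm_eq_abs, ← norm_smul]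
    rfl
  obtain ⟨k, hk, hkf, -⟩ := huniv (V.induced T) ι.toLinearMap
    (fun v => (hι v).trans_le <|
      max_le (mul_le_of_le_one_left (norm_nonneg _) hε1.le) (hf v))
    (fun u => (hι (e u)).trans_le <|
      max_le (mul_le_mul_of_nonneg_left (he u) hε0.le) (hfe u))
  have hfι : Contraction (f ∘ₗ ι.symm.toLinearMap) := fun q => by
    obtain ⟨v, rfl⟩ := ι.surjective q
    simp [hι]
  refine ⟨fun y => ⟨ι.symm (k y), ?_⟩, fun x => ?_⟩
  · obtain ⟨k₀, -, -, huniq⟩ := huniv W f hf hfe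
    have h₁ := huniq LinearMap.id (fun _ => le_rfl) (fun _ => by simp) y
    have h₂ := huniq ((f ∘ₗ ι.symm.toLinearMap) ∘ₗ k)
      (fun w => (hfι _).trans (hk w))
      (fun v => by simpa using hfι.norm_sub_eq_zero (hkf v)) y
    exact norm_sub_eq_zero_trans (norm_sub_eq_zero_symm h₁) h₂
  · calc ε * ‖x‖ ≤ ‖ι x‖ := (le_max_left _ _).trans_eq (hι x).symm
      _ = ‖k (f x)‖ := norm_eq_of_norm_sub_eq_zero (hkf x)
      _ ≤ ‖f x‖ := hk _

/-- An essentially surjective contraction that is bounded below by `ε` has a linear inverse up to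
null difference, and the inverse becomes a contraction when scaled by `ε`. -/
theorem exists_linear_inverse_of_essSurj_of_bound (hε : 0 < ε)
    (hsurj : ∀ y : W.carrier, ∃ x : V.carrier, ‖y - f x‖ = 0)
    (hbd : ∀ x : V.carrier, ε * ‖x‖ ≤ ‖f x‖) :
    ∃ s : W.carrier →ₗ[ℝ] V.carrier, (∀ y, ‖f (s y) - y‖ = 0) ∧
      (∀ x, ‖s (f x) - x‖ = 0) ∧ Contraction (ε • s) := by
  obtain ⟨s, hs⟩ := exists_linear_section_of_essSurj f hsurj
  refine ⟨s, hs, fun x => ?_, fun y => ?_⟩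
  · have := hbd (s (f x) - x)
    rw [map_sub, hs] at this
    exact le_antisymm (nonpos_of_mul_nonpos_right this hε) (norm_nonneg _)
  · rw [LinearMap.smul_apply, norm_smul, Real.norm_of_nonneg hε.le]
    exact (hbd _).trans_eq (norm_eq_of_norm_sub_eq_zero (hs y))

theorem exists_isEpsKernel_of_essSurj_of_bound (hε : 0 < ε)
    (hsurj : ∀ y : W.carrier, ∃ x : V.carrier, ‖y - f x‖ = 0)
    (hbd : ∀ x : V.carrier, ε * ‖x‖ ≤ ‖f x‖) :
    ∃ (X : SNS.{u}) (g : W.carrier →ₗ[ℝ] X.carrier), Contraction g ∧ IsEpsKernel ε f g := by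
  obtain ⟨s, hfs, hsf, hs⟩ := exists_linear_inverse_of_essSurj_of_bound hε hsurj hbd
  have hnorm (w : W.carrier) : ‖(ε • s) w‖ = ε * ‖s w‖ := by
    rw [LinearMap.smul_apply, norm_smul, Real.norm_of_nonneg hε.le]
  refine ⟨V, ε • s, hs, fun x => ?_, fun U h hh hsh => ?_⟩
  · rw [hnorm, norm_eq_of_norm_sub_eq_zero (hsf x)]
  · refine ⟨s ∘ₗ h, fun u => ?_, fun u => norm_sub_eq_zero_symm (hfs (h u)),
      fun k' _ hfk' u => ?_⟩
    · exact le_of_mul_le_mul_left ((hnorm _).symm.trans_le (hsh u)) hε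
    · have h₁ := hbd (s (h u) - k' u)
      rw [map_sub, norm_sub_eq_zero_trans (hfs (h u)) (hfk' u)] at h₁
      exact le_antisymm (nonpos_of_mul_nonpos_right h₁ hε) (norm_nonneg _)

theorem exists_isEpsCokernel_of_essSurj_of_bound (hε : 0 < ε)
    (hsurj : ∀ y : W.carrier, ∃ x : V.carrier, ‖y - f x‖ = 0)
    (hbd : ∀ x : V.carrier, ε * ‖x‖ ≤ ‖f x‖) :
    ∃ (U : SNS.{u}) (e : U.carrier →ₗ[ℝ] V.carrier), Contraction e ∧ IsEpsCokernel ε e f := by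
  obtain ⟨s, hfs, hsf, hs⟩ := exists_linear_inverse_of_essSurj_of_bound hε hsurj hbd
  refine ⟨W, ε • s, hs, fun w => ?_, fun X h hh hhs => ?_⟩
  · rw [LinearMap.smul_apply, map_smul, norm_smul, Real.norm_of_nonneg hε.le,
      norm_eq_of_norm_sub_eq_zero (hfs w)]
  · refine ⟨h ∘ₗ s, fun w => ?_, fun v => hh.norm_sub_eq_zero (norm_sub_eq_zero_symm (hsf v)),
      fun k' hk' hk'f w => ?_⟩
    · have h₁ := hhs w
      rw [LinearMap.smul_apply, map_smul, norm_smul, Real.norm_of_nonneg hε.le] at h₁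
      exact le_of_mul_le_mul_left h₁ hε
    · exact norm_sub_eq_zero_trans (hk'f (s w)) (hk'.norm_sub_eq_zero (hfs w))

end

/-- For a linear contraction `f : V → W` between real seminormed spaces and `ε ∈ (0,1)`,
the following are equivalent: `f` is a normal ε-monomorphism (an ε-kernel of some
contraction out of `W`); `f` is a normal ε-epimorphism (an ε-cokernel of some contraction
into `V`); `f` is essentially surjective and satisfies `ε ‖x‖ ≤ ‖f x‖` for all `x`. -/
theorem stmt15 (ε : ℝ) (hε : ε ∈ Set.Ioo (0 : ℝ) 1) {V W : SNS.{u}}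
    (f : V.carrier →ₗ[ℝ] W.carrier) (hf : Contraction f) :
    ((∃ (X : SNS.{u}) (g : W.carrier →ₗ[ℝ] X.carrier), Contraction g ∧ IsEpsKernel ε f g) ↔
      (∃ (U : SNS.{u}) (e : U.carrier →ₗ[ℝ] V.carrier), Contraction e ∧ IsEpsCokernel ε e f)) ∧
    ((∃ (X : SNS.{u}) (g : W.carrier →ₗ[ℝ] X.carrier), Contraction g ∧ IsEpsKernel ε f g) ↔
      ((∀ y : W.carrier, ∃ x : V.carrier, ‖y - f x‖ = 0) ∧
        ∀ x : V.carrier, ε * ‖x‖ ≤ ‖f x‖)) := by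
  have hmono : (∃ (X : SNS.{u}) (g : W.carrier →ₗ[ℝ] X.carrier),
      Contraction g ∧ IsEpsKernel ε f g) ↔
      ((∀ y : W.carrier, ∃ x : V.carrier, ‖y - f x‖ = 0) ∧
        ∀ x : V.carrier, ε * ‖x‖ ≤ ‖f x‖) :=
    ⟨fun ⟨_, _, hg, h⟩ => h.essSurj_and_bound hε hf hg,
      fun ⟨hsurj, hbd⟩ => exists_isEpsKernel_of_essSurj_of_bound hε.1 hsurj hbd⟩
  exact ⟨hmono.trans
    ⟨fun ⟨hsurj, hbd⟩ => exists_isEpsCokernel_of_essSurj_of_bound hε.1 hsurj hbd,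
      fun ⟨_, _, he, h⟩ => h.essSurj_and_bound hε hf he⟩, hmono⟩
end

section
/- Fix ε ∈ (0,1) and let (V, ‖·‖) be a real seminormed space. Then the assignment sending a seminorm |·| on V satisfying ‖x‖ ≤ |x| ≤ ε⁻¹‖x‖ for all x to the identity map (V, |·|) → (V, ‖·‖) establishes a bijection between such seminorms and the normal ε-subobjects of (V, ‖·‖) (i.e., equivalence classes, up to isomorphism over V, of normal ε-monomorphisms into (V, ‖·‖)); moreover this bijection is order-reversing from the pointwise order on seminorms to the factorization order on normal subobjects. -/
universe u

/-- If a seminorm is bounded by a multiple of the norm, it does not see null differences. -/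
theorem Seminorm.eq_of_norm_sub_eq_zero {V : Type*} [SeminormedAddCommGroup V] [NormedSpace ℝ V]
    {P : Seminorm ℝ V} {C : ℝ} (hP : ∀ x, P x ≤ C * ‖x‖) {x y : V} (h : ‖x - y‖ = 0) :
    P x = P y := by
  have h0 : P (x - y) ≤ 0 := by simpa [h] using hP (x - y)
  have h1 : |P x - P y| ≤ P (x - y) := abs_sub_map_le_sub P x y
  exact sub_eq_zero.1 (abs_nonpos_iff.1 (h1.trans h0))

/-- An essentially surjective linear map into a seminormed space has a linear right inverse
up to null vectors. -/
theorem LinearMap.exists_essential_rightInverse {U V : Type*} [AddCommGroup U] [Module ℝ U]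
    [SeminormedAddCommGroup V] [NormedSpace ℝ V] (f : U →ₗ[ℝ] V)
    (hf : ∀ y, ∃ u, ‖y - f u‖ = 0) : ∃ g : V →ₗ[ℝ] U, ∀ y, ‖f (g y) - y‖ = 0 := by
  let π : V →ₗ[ℝ] SeparationQuotient V := (SeparationQuotient.mkCLM ℝ V).toLinearMap
  have hπ (x y : V) : π x = π y ↔ ‖x - y‖ = 0 := by
    rw [← dist_eq_norm, ← Metric.inseparable_iff]
    exact SeparationQuotient.mk_eq_mk
  have hsurj : Function.Surjective (π ∘ₗ f) := by
    intro q
    obtain ⟨y, rfl⟩ := SeparationQuotient.surjective_mk q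
    obtain ⟨u, hu⟩ := hf y
    exact ⟨u, ((hπ y (f u)).2 hu).symm⟩
  obtain ⟨s, hs⟩ := (π ∘ₗ f).exists_rightInverse_of_surjective (LinearMap.range_eq_top.2 hsurj)
  exact ⟨s ∘ₗ π, fun y ↦ (hπ _ _).1 (LinearMap.congr_fun hs (π y))⟩

/-- For `ε ∈ (0,1)` and a real seminormed space `(V, ‖·‖)`, the assignment sending a
seminorm `P` with `‖x‖ ≤ P x ≤ ε⁻¹ ‖x‖` to the identity map `(V, P) → (V, ‖·‖)` is an
order-reversing bijection onto the normal ε-subobjects of `(V, ‖·‖)`: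
(a) each such identity map is a normal ε-monomorphism (a contraction, essentially
surjective, with `ε · P x ≤ ‖x‖`);
(b) two seminorms giving isomorphic-over-`V` subobjects are equal (injectivity);
(c) every normal ε-monomorphism into `(V, ‖·‖)` is isomorphic over `V` to such an
identity map (surjectivity);
(d) `P ≤ P'` pointwise iff the subobject of `P'` is below the subobject of `P` in the
factorization order (order reversal). -/
theorem stmt16 (ε : ℝ) (hε : ε ∈ Set.Ioo (0 : ℝ) 1)
    (V : Type u) [SeminormedAddCommGroup V] [NormedSpace ℝ V] :
    -- (a) well-definedness: the identity `(V, P) → (V, ‖·‖)` is a normal ε-mono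
    (∀ P : Seminorm ℝ V, (∀ x, ‖x‖ ≤ P x ∧ P x ≤ ε⁻¹ * ‖x‖) →
      ((∀ x, ‖x‖ ≤ P x) ∧ (∀ y : V, ∃ x : V, ‖y - x‖ = 0) ∧ ∀ x, ε * P x ≤ ‖x‖)) ∧
    -- (b) injectivity: if the identities of `(V, P)` and `(V, P')` represent the same
    -- normal ε-subobject of `(V, ‖·‖)`, then `P = P'`
    (∀ P P' : Seminorm ℝ V, (∀ x, ‖x‖ ≤ P x ∧ P x ≤ ε⁻¹ * ‖x‖) →
      (∀ x, ‖x‖ ≤ P' x ∧ P' x ≤ ε⁻¹ * ‖x‖) →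
      (∃ φ : V →ₗ[ℝ] V, (∀ x, P' (φ x) ≤ P x) ∧
        (∃ ψ : V →ₗ[ℝ] V, (∀ x, P (ψ x) ≤ P' x) ∧
          (∀ x, P (ψ (φ x) - x) = 0) ∧ (∀ x, P' (φ (ψ x) - x) = 0)) ∧
        (∀ x, ‖x - φ x‖ = 0)) →
      P = P') ∧
    -- (c) surjectivity: every normal ε-mono `f : U → (V, ‖·‖)` represents the same
    -- normal ε-subobject as the identity of `(V, P)` for some admissible seminorm `P`
    (∀ (U : SNS.{u}) (f : U.carrier →ₗ[ℝ] V),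
      (∀ u, ‖f u‖ ≤ ‖u‖) → (∀ y : V, ∃ u : U.carrier, ‖y - f u‖ = 0) →
      (∀ u, ε * ‖u‖ ≤ ‖f u‖) →
      ∃ P : Seminorm ℝ V, (∀ x, ‖x‖ ≤ P x ∧ P x ≤ ε⁻¹ * ‖x‖) ∧
        ∃ φ : U.carrier →ₗ[ℝ] V, (∀ u, P (φ u) ≤ ‖u‖) ∧
          (∃ ψ : V →ₗ[ℝ] U.carrier, (∀ x, ‖ψ x‖ ≤ P x) ∧
            (∀ u, ‖ψ (φ u) - u‖ = 0) ∧ (∀ x, P (φ (ψ x) - x) = 0)) ∧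
          ∀ u, ‖f u - φ u‖ = 0) ∧
    -- (d) order reversal: `P ≤ P'` pointwise iff the subobject of `P'` factors through
    -- the subobject of `P`
    (∀ P P' : Seminorm ℝ V, (∀ x, ‖x‖ ≤ P x ∧ P x ≤ ε⁻¹ * ‖x‖) →
      (∀ x, ‖x‖ ≤ P' x ∧ P' x ≤ ε⁻¹ * ‖x‖) →
      ((∀ x, P x ≤ P' x) ↔
        ∃ h : V →ₗ[ℝ] V, (∀ x, P (h x) ≤ P' x) ∧ ∀ x, ‖h x - x‖ = 0)) := by
  obtain ⟨hε0, -⟩ := hε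
  refine ⟨fun P hP ↦ ⟨fun x ↦ (hP x).1, fun y ↦ ⟨y, by simp⟩, fun x ↦ ?_⟩, ?_, ?_, ?_⟩
  · exact (le_inv_mul_iff₀ hε0).1 (hP x).2
  · rintro P P' hP hP' ⟨φ, hφ, ⟨ψ, hψ, hψφ, -⟩, hid⟩
    ext x
    have h1 : P' x = P' (φ x) := Seminorm.eq_of_norm_sub_eq_zero (fun y ↦ (hP' y).2) (hid x)
    have h2 : P (ψ (φ x)) = P x :=
      Seminorm.eq_of_norm_sub_eq_zero (fun y ↦ (hP y).2)
        (le_antisymm ((hP _).1.trans (hψφ x).le) (norm_nonneg _))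
    have h3 := hφ x
    have h4 := hψ (φ x)
    linarith
  · intro U f hf hsurj hlower
    obtain ⟨ψ, hψ⟩ := f.exists_essential_rightInverse hsurj
    have hnorm (x : V) : ‖f (ψ x)‖ = ‖x‖ :=
      Seminorm.eq_of_norm_sub_eq_zero (P := normSeminorm ℝ V) (C := 1) (by simp) (hψ x)
    have hnull (u : U.carrier) (hu : ‖f u‖ = 0) : ‖u‖ = 0 := by
      have h := hlower u
      rw [hu] at h
      exact le_antisymm (nonpos_of_mul_nonpos_right h hε0) (norm_nonneg u)
    have hψf (u : U.carrier) : ‖ψ (f u) - u‖ = 0 :=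
      hnull _ (by rw [map_sub]; exact hψ (f u))
    refine ⟨(normSeminorm ℝ U.carrier).comp ψ, fun x ↦ ⟨?_, ?_⟩, f, fun u ↦ ?_,
      ⟨ψ, fun x ↦ le_rfl, hψf, fun x ↦ ?_⟩, by simp⟩
    · exact (hnorm x).symm.le.trans (hf (ψ x))
    · exact (le_inv_mul_iff₀ hε0).2 ((hlower (ψ x)).trans (hnorm x).le)
    · exact (Seminorm.eq_of_norm_sub_eq_zero (P := normSeminorm ℝ U.carrier) (C := 1) (by simp)
        (hψf u)).le
    · exact hnull _ ((hnorm _).trans (hψ x))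
  · intro P P' hP _
    refine ⟨fun h ↦ ⟨LinearMap.id, h, by simp⟩, ?_⟩
    rintro ⟨h, hle, hid⟩ x
    exact (Seminorm.eq_of_norm_sub_eq_zero (fun y ↦ (hP y).2) (hid x)).symm.le.trans (hle x)
end

section
/- On ℝ², let p₁(x) := (1/4)‖x‖₁, p₂(x) := (1/3)‖x‖∞, and p₃(x) := (1/5)‖x‖₁, where ‖·‖₁ and ‖·‖∞ are the ℓ¹ and ℓ∞ norms. Let p □ q denote the infimal convolution (p □ q)(x) = inf{ p(x₁) + q(x₂) : x₁ + x₂ = x }, and let p ∨ q denote the pointwise maximum. Then (p₁ □ (p₂ ∨ p₃))(7/2, 3/2) = 17/16 while ((p₁ □ p₂) ∨ p₃)(7/2, 3/2) = 1. In particular, since p₁ is pointwise at least p₃, the modular law p₁ □ (p₂ ∨ p₃) = (p₁ □ p₂) ∨ p₃ fails, so the lattice of seminorms on ℝ² with join given by infimal convolution and meet given by pointwise maximum is not modular. -/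
/-- The infimal convolution (the join in the lattice of seminorms). -/
noncomputable def infConv (p q : ℝ × ℝ → ℝ) (x : ℝ × ℝ) : ℝ :=
  ⨅ y : ℝ × ℝ, (p y + q (x - y))

/-- The ℓ¹ norm on ℝ². -/
def l1 (x : ℝ × ℝ) : ℝ := |x.1| + |x.2|

/-- The ℓ∞ norm on ℝ². -/
def linf (x : ℝ × ℝ) : ℝ := max |x.1| |x.2|

theorem infConv_eq_of_attained {p q : ℝ × ℝ → ℝ} {x : ℝ × ℝ} {c : ℝ} (y : ℝ × ℝ)
    (hy : p y + q (x - y) = c) (hc : ∀ z, c ≤ p z + q (x - z)) : infConv p q x = c :=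
  le_antisymm ((ciInf_le ⟨c, Set.forall_mem_range.2 hc⟩ y).trans_eq hy) (le_ciInf hc)

/-- With `p₁ = (1/4)‖·‖₁`, `p₂ = (1/3)‖·‖∞`, `p₃ = (1/5)‖·‖₁` on `ℝ²`, one has
`(p₁ □ (p₂ ∨ p₃))(7/2, 3/2) = 17/16` while `((p₁ □ p₂) ∨ p₃)(7/2, 3/2) = 1`; since
`p₃ ≤ p₁` pointwise, the modular law `p₁ □ (p₂ ∨ p₃) = (p₁ □ p₂) ∨ p₃` fails, so the
lattice of seminorms on `ℝ²` (join: infimal convolution, meet: pointwise max) is not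
modular. -/
theorem stmt17 :
    let p₁ : ℝ × ℝ → ℝ := fun x => (1 / 4) * l1 x
    let p₂ : ℝ × ℝ → ℝ := fun x => (1 / 3) * linf x
    let p₃ : ℝ × ℝ → ℝ := fun x => (1 / 5) * l1 x
    infConv p₁ (fun x => max (p₂ x) (p₃ x)) (7 / 2, 3 / 2) = 17 / 16 ∧
    max (infConv p₁ p₂ (7 / 2, 3 / 2)) (p₃ (7 / 2, 3 / 2)) = 1 ∧
    (∀ x, p₃ x ≤ p₁ x) ∧
    ¬ (∀ x, infConv p₁ (fun y => max (p₂ y) (p₃ y)) x = max (infConv p₁ p₂ x) (p₃ x)) := by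
  intro p₁ p₂ p₃
  have h₁ : infConv p₁ (fun x => max (p₂ x) (p₃ x)) (7 / 2, 3 / 2) = 17 / 16 := by
    refine infConv_eq_of_attained (5 / 4, 0) (by norm_num [p₁, p₂, p₃, l1, linf, abs_of_pos]) ?_
    rintro ⟨a, b⟩
    simp only [p₁, p₂, p₃, l1, linf, Prod.mk_sub_mk]
    have hp₂ := le_max_left (1 / 3 * max |7 / 2 - a| |3 / 2 - b|)
      (1 / 5 * (|7 / 2 - a| + |3 / 2 - b|))
    have hp₃ := le_max_right (1 / 3 * max |7 / 2 - a| |3 / 2 - b|)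
      (1 / 5 * (|7 / 2 - a| + |3 / 2 - b|))
    linarith [le_max_left |7 / 2 - a| |3 / 2 - b|, le_abs_self a, le_abs_self b, abs_nonneg b,
      le_abs_self (7 / 2 - a), le_abs_self (3 / 2 - b)]
  have h₂ : infConv p₁ p₂ (7 / 2, 3 / 2) = 1 := by
    refine infConv_eq_of_attained (2, 0) (by norm_num [p₁, p₂, l1, linf, abs_of_pos]) ?_
    rintro ⟨a, b⟩
    simp only [p₁, p₂, l1, linf, Prod.mk_sub_mk]
    linarith [le_max_left |7 / 2 - a| |3 / 2 - b|, le_max_right |7 / 2 - a| |3 / 2 - b|,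
      le_abs_self a, le_abs_self b, abs_nonneg b,
      le_abs_self (7 / 2 - a), le_abs_self (3 / 2 - b)]
  have h₃ : max (infConv p₁ p₂ (7 / 2, 3 / 2)) (p₃ (7 / 2, 3 / 2)) = 1 := by
    rw [h₂]
    norm_num [p₃, l1, abs_of_pos]
  refine ⟨h₁, h₃, fun x => ?_, fun h => ?_⟩
  · simp only [p₁, p₃, l1]
    linarith [abs_nonneg x.1, abs_nonneg x.2]
  · have h₄ := h (7 / 2, 3 / 2)
    rw [h₁, h₃] at h₄
    norm_num at h₄
end
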